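/- Let p ≡ 1 (mod 3) be a prime represented by the principal form x² + 27C²Dy², where D > 1 is squarefree and C = C(u) for u = A + B√D in S_D. Then u is a cubic residue modulo p (given gcd(p, 3N(u)D) = 1 and the representing y coprime to p). -/

import Mathlib

/-- `Cval A B D` is the product of the distinct odd primes that divide `gcd(A, B)`
but do not divide `D`. -/
def Cval (A B D : ℤ) : ℤ :=
  ∏ q ∈ (Int.gcd A B).primeFactors.filter (fun q : ℕ => Odd q ∧ ¬ ((q : ℤ) ∣ D)), (q : ℤ)

/-- `A + B√D` is a cube in the ring of integers of `ℚ(√D)`: there is an algebraic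
integer `r + s√D` (with `r, s ∈ ℚ`) whose cube is `A + B√D`. -/
def IsCubeInO (D A B : ℤ) : Prop :=
  ∃ r s : ℚ, IsIntegral ℤ ((r : ℝ) + (s : ℝ) * Real.sqrt D) ∧
    ((r : ℝ) + (s : ℝ) * Real.sqrt D) ^ 3 = (A : ℝ) + (B : ℝ) * Real.sqrt D

/-- Membership of `u = A + B√D` in the set `𝒮_D`: the norm `A² - B²D` is a perfect
cube, `u` is not a cube in the ring of integers of `ℚ(√D)`, and `gcd(A, B)` is not
divisible by the cube of a prime. -/
def InSD (D A B : ℤ) : Prop :=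
  (∃ n : ℤ, A ^ 2 - B ^ 2 * D = n ^ 3) ∧ ¬ IsCubeInO D A B ∧
    ∀ p : ℕ, p.Prime → ¬ (p ^ 3 ∣ Int.gcd A B)

/-- The ring of Eisenstein integers `ℤ[ω]`, where `ω ^ 2 = -1 - ω`. -/
abbrev Eis : Type := QuadraticAlgebra ℤ (-1) (-1)

namespace Eis

open QuadraticAlgebra

/-- The primitive cube root of unity of `ℤ[ω]`. -/
abbrev om : Eis := ⟨0, 1⟩

/-- The square root `1 + 2ω` of `-3` in `ℤ[ω]`. -/
abbrev sqrtNegThree : Eis := ⟨1, 2⟩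

lemma norm_eq (z : Eis) : norm z = z.re ^ 2 - z.re * z.im + z.im ^ 2 := by
  rw [norm_def]; ring

lemma norm_nonneg (z : Eis) : 0 ≤ norm z := by
  rw [norm_eq]; nlinarith [sq_nonneg (2 * z.re - z.im), sq_nonneg z.im]

lemma norm_eq_zero {z : Eis} : norm z = 0 ↔ z = 0 := by
  refine ⟨fun h => ?_, fun h => by rw [h, QuadraticAlgebra.norm_zero]⟩
  rw [norm_eq] at h
  have him : z.im = 0 := by
    nlinarith [sq_nonneg (2 * z.re - z.im), sq_nonneg z.im]
  have hre : z.re = 0 := by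
    rw [him] at h; nlinarith
  exact QuadraticAlgebra.ext hre him

lemma mul_star_self (z : Eis) : z * star z = ((norm z : ℤ) : Eis) := by
  rw [← algebraMap_norm_eq_mul_star]; rfl

lemma om_cube : om ^ 3 = 1 := by decide

instance : NoZeroDivisors Eis where
  eq_zero_or_eq_zero_of_mul_eq_zero {a b} h := by
    have := congrArg QuadraticAlgebra.norm h
    rw [map_mul, QuadraticAlgebra.norm_zero, mul_eq_zero] at this
    exact this.imp norm_eq_zero.1 norm_eq_zero.1

instance : IsDomain Eis := NoZeroDivisors.to_isDomain _

instance : CharZero Eis where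
  cast_injective a b h := by
    have := congrArg QuadraticAlgebra.re h
    simpa using this

lemma om_primitive : IsPrimitiveRoot om 3 := by
  rw [IsPrimitiveRoot.iff_orderOf]
  exact orderOf_eq_prime om_cube (by decide)

/-- The cube roots of unity in `ℤ[ω]`. -/
lemma eq_of_cube_eq_one {u : Eis} (h : u ^ 3 = 1) : u = 1 ∨ u = om ∨ u = om ^ 2 := by
  obtain ⟨i, hi, rfl⟩ := om_primitive.eq_pow_of_pow_eq_one h
  interval_cases i <;> simp

lemma star_eq_sq_of_cube_eq_one {u : Eis} (h : u ^ 3 = 1) : star u = u ^ 2 := by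
  rcases eq_of_cube_eq_one h with rfl | rfl | rfl <;> decide

/-- The algebraically closed field of characteristic `q` in which residues are compared. -/
abbrev Fbar (q : ℕ) [Fact q.Prime] : Type := AlgebraicClosure (ZMod q)

section

variable {q : ℕ} [Fact q.Prime]

lemma om_rel (φ : Eis →+* Fbar q) : φ om ^ 2 = -1 - φ om := by
  have : om ^ 2 = -1 - om := by decide
  rw [← map_pow, this]; simp

lemma map_eq (φ : Eis →+* Fbar q) (z : Eis) : φ z = (z.re : Fbar q) + z.im * φ om := by
  have : z = (z.re : Eis) + (z.im : Eis) * om := by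
    ext <;> simp
  conv_lhs => rw [this, map_add, map_mul, map_intCast, map_intCast]

lemma exists_hom (q : ℕ) [Fact q.Prime] : Nonempty (Eis →+* Fbar q) := by
  obtain ⟨u, hu⟩ := IsAlgClosed.exists_root
    (Polynomial.X ^ 2 + Polynomial.X + 1 : Polynomial (Fbar q)) (by
      have : (Polynomial.X ^ 2 + Polynomial.X + 1 : Polynomial (Fbar q)).degree = 2 := by
        compute_degree!
      rw [this]; decide)
  simp only [Polynomial.IsRoot, Polynomial.eval_add, Polynomial.eval_pow, Polynomial.eval_X,
    Polynomial.eval_one] at hu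
  exact ⟨(QuadraticAlgebra.lift ⟨u, by simp; linear_combination hu⟩ :
    Eis →ₐ[ℤ] Fbar q).toRingHom⟩

lemma three_ne_zero' (hq3 : q ≠ 3) : (3 : Fbar q) ≠ 0 := by
  intro h
  have : ((3 : ℕ) : Fbar q) = 0 := by exact_mod_cast h
  rw [CharP.cast_eq_zero_iff (Fbar q) q] at this
  exact hq3 ((Nat.prime_dvd_prime_iff_eq Fact.out Nat.prime_three).1 this)

lemma intCast_ne_zero {m : ℤ} (h : ¬ (q : ℤ) ∣ m) : (m : Fbar q) ≠ 0 := by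
  rwa [Ne, CharP.intCast_eq_zero_iff (Fbar q) q]

lemma hom_injOn_cube_roots (hq3 : q ≠ 3) (φ : Eis →+* Fbar q) {u v : Eis} (hu : u ^ 3 = 1)
    (hv : v ^ 3 = 1) (h : φ u = φ v) : u = v := by
  have h3 := three_ne_zero' hq3
  have hr := om_rel φ
  have h1 : φ om ≠ 1 := fun h => h3 (by rw [h] at hr; linear_combination hr)
  have h0 : φ om ≠ 0 := fun h => by rw [h] at hr; simp at hr
  have h2 : φ om ^ 2 ≠ 1 := fun h => by
    have : φ om = 1 := by
      have h3 : φ om ^ 3 = 1 := by rw [← map_pow, om_cube, map_one]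
      rw [pow_succ, h, one_mul] at h3; exact h3
    exact h1 this
  have h4 : φ om ^ 2 ≠ φ om := fun h => h1 (mul_left_cancel₀ h0 (by linear_combination h))
  rcases eq_of_cube_eq_one hu with rfl | rfl | rfl <;>
  rcases eq_of_cube_eq_one hv with rfl | rfl | rfl <;>
  simp only [map_one, map_pow] at h <;> first | rfl | exact absurd h ‹_› | exact absurd h.symm ‹_›

/-- `3` divides `q ^ 2 - 1` for a prime `q ≠ 3`. -/
lemma three_mul_div (hq3 : q ≠ 3) : 3 * ((q ^ 2 - 1) / 3) = q ^ 2 - 1 := by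
  apply Nat.mul_div_cancel'
  have hq : q.Prime := Fact.out
  have : ¬ 3 ∣ q := fun h => hq3 ((Nat.prime_dvd_prime_iff_eq Nat.prime_three hq).1 h).symm
  have h1 : q ^ 2 % 3 = 1 := by
    have : q % 3 = 1 ∨ q % 3 = 2 := by omega
    rcases this with h | h <;> simp [Nat.pow_mod, h]
  have := hq.one_lt
  have : 1 ≤ q ^ 2 := Nat.one_le_pow _ _ (by omega)
  omega

lemma om_map_frob (hq3 : q ≠ 3) (φ : Eis →+* Fbar q) : φ om ^ (q ^ 2) = φ om := by
  have hq : q.Prime := Fact.out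
  have : 1 ≤ q ^ 2 := Nat.one_le_pow _ _ hq.pos
  rw [show q ^ 2 = 3 * ((q ^ 2 - 1) / 3) + 1 by rw [three_mul_div hq3]; omega, pow_succ, pow_mul,
    ← map_pow, om_cube]
  simp

lemma intCast_pow_sq (m : ℤ) : (m : Fbar q) ^ (q ^ 2) = m := by
  have h : (m : Fbar q) ^ q = m := by
    rw [← map_intCast (algebraMap (ZMod q) (Fbar q)), ← map_pow, ZMod.pow_card]
  rw [pow_two, pow_mul, h, h]

lemma map_pow_sq (hq3 : q ≠ 3) (φ : Eis →+* Fbar q) (z : Eis) : φ z ^ (q ^ 2) = φ z := by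
  rw [map_eq φ z, add_pow_char_pow, mul_pow, intCast_pow_sq, intCast_pow_sq, om_map_frob hq3]

lemma pow_three_mul (hq3 : q ≠ 3) (x : Fbar q) (h0 : x ≠ 0) (h : x ^ (q ^ 2) = x) :
    x ^ (3 * ((q ^ 2 - 1) / 3)) = 1 := by
  have hq : q.Prime := Fact.out
  have : 1 ≤ q ^ 2 := Nat.one_le_pow _ _ hq.pos
  apply mul_right_cancel₀ h0
  rw [three_mul_div hq3, ← pow_succ, one_mul, Nat.sub_add_cancel this, h]

end

/-- The relation `(α / q)₃ = u` for the cubic residue symbol of `α` modulo a rational prime `q`,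
in the torus form `(ᾱ / α) ^ ((q ^ 2 - 1) / 3) = u`. -/
def HasSymbol (q : ℕ) [Fact q.Prime] (α u : Eis) : Prop :=
  ∀ φ : Eis →+* Fbar q,
    φ (star α) ^ ((q ^ 2 - 1) / 3) = φ u * φ α ^ ((q ^ 2 - 1) / 3)

namespace HasSymbol

variable {q : ℕ} [Fact q.Prime] {α β u v : Eis}

lemma mul (h : HasSymbol q α u) (h' : HasSymbol q β v) : HasSymbol q (α * β) (u * v) := fun φ => by
  rw [star_mul', map_mul, map_mul, map_mul, mul_pow, mul_pow, h φ, h' φ]; ring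

lemma intCast (m : ℤ) : HasSymbol q (m : Eis) 1 := fun φ => by
  have : star (m : Eis) = m := by ext <;> simp
  rw [this, map_one, one_mul]

lemma intCast_mul (m : ℤ) (h : HasSymbol q α u) : HasSymbol q (m * α) u := by
  simpa using (intCast m).mul h

lemma congr_of_dvd (h : HasSymbol q α u) (γ : Eis) : HasSymbol q (α + (q : Eis) * γ) u :=
  fun φ => by
  have : star (q : Eis) = q := by ext <;> simp
  rw [star_add, star_mul', this, map_add, map_mul, map_add, map_mul]
  simpa using h φ

lemma even_exponent (hq2 : q ≠ 2) : Even ((q ^ 2 - 1) / 3) := by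
  have hq : q.Prime := Fact.out
  have hodd := hq.eq_two_or_odd.resolve_left hq2
  have h1 : q ^ 2 % 2 = 1 := by simp [Nat.pow_mod, hodd]
  by_cases hq3 : q = 3
  · subst hq3; decide
  · have := three_mul_div hq3
    rw [Nat.even_iff]; omega

lemma neg_one_pow : (-1 : Fbar q) ^ ((q ^ 2 - 1) / 3) = 1 := by
  by_cases hq2 : q = 2
  · subst hq2
    norm_num
    have : ((2 : ℕ) : Fbar 2) = 0 := CharP.cast_eq_zero _ _
    push_cast at this
    linear_combination -this
  · exact (even_exponent hq2).neg_one_pow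

lemma sqrtNegThree : HasSymbol q sqrtNegThree 1 := fun φ => by
  have : star Eis.sqrtNegThree = -1 * Eis.sqrtNegThree := by decide
  rw [this, map_mul, mul_pow, map_neg, map_one, neg_one_pow]

lemma unique (hq3 : q ≠ 3) (hN : ¬ (q : ℤ) ∣ norm α) (hu : u ^ 3 = 1) (hv : v ^ 3 = 1)
    (h : HasSymbol q α u) (h' : HasSymbol q α v) : u = v := by
  obtain ⟨φ⟩ := exists_hom q
  refine hom_injOn_cube_roots hq3 φ hu hv ?_
  have h0 : φ α ≠ 0 := by
    intro h0
    have := congrArg φ (mul_star_self α)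
    rw [map_mul, h0, zero_mul, map_intCast] at this
    exact intCast_ne_zero hN this.symm
  exact mul_right_cancel₀ (pow_ne_zero _ h0) ((h φ).symm.trans (h' φ))

end HasSymbol

/-- The cubic character `m ↦ ω ^ ((m ^ 2 - 1) / 3)` modulo `9`. -/
def omChar : ZMod 9 →* Eis where
  toFun m := if m = 1 ∨ m = 8 then 1 else if m = 2 ∨ m = 7 then om else
    if m = 4 ∨ m = 5 then om ^ 2 else 0
  map_one' := by decide
  map_mul' := by decide

/-- `omChar` on integers. -/
def omSymbol : ℤ →* Eis := omChar.comp (Int.castRingHom (ZMod 9)).toMonoidHom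

lemma omSymbol_apply (m : ℤ) : omSymbol m = omChar (m : ZMod 9) := rfl

lemma omSymbol_natCast {q : ℕ} (h : ¬ 3 ∣ q) : omSymbol q = om ^ ((q ^ 2 - 1) / 3) := by
  rw [omSymbol_apply]
  have hlt : q % 9 < 9 := Nat.mod_lt _ (by norm_num)
  have hq : q = 9 * (q / 9) + q % 9 := (Nat.div_add_mod q 9).symm
  have hc : ((q : ℤ) : ZMod 9) = ((q % 9 : ℕ) : ZMod 9) := by simp
  rw [hc]
  generalize q % 9 = r at *
  generalize q / 9 = j at *
  subst hq
  have key : ∀ s, 1 ≤ r → r ^ 2 - 1 = 3 * s →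
      om ^ (((9 * j + r) ^ 2 - 1) / 3) = om ^ s := by
    intro s hr hs
    have h1 : 1 ≤ r ^ 2 := Nat.one_le_pow _ _ hr
    have : (9 * j + r) ^ 2 - 1 = 3 * (3 * (9 * j ^ 2 + 2 * j * r) + s) := by
      have : (9 * j + r) ^ 2 = 9 * (9 * j ^ 2 + 2 * j * r) + r ^ 2 := by ring
      omega
    rw [this, Nat.mul_div_cancel_left _ (by norm_num), pow_add, pow_mul, om_cube, one_pow, one_mul]
  interval_cases r
  · omega
  · rw [key 0 (by norm_num) (by norm_num)]; decide
  · rw [key 1 (by norm_num) (by norm_num)]; decide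
  · omega
  · rw [key 5 (by norm_num) (by norm_num)]; decide
  · rw [key 8 (by norm_num) (by norm_num)]; decide
  · omega
  · rw [key 16 (by norm_num) (by norm_num)]; decide
  · rw [key 21 (by norm_num) (by norm_num)]; decide

lemma hasSymbol_om {q : ℕ} [Fact q.Prime] (hq3 : q ≠ 3) : HasSymbol q om (omSymbol q) :=
    fun φ => by
  have hq : q.Prime := Fact.out
  have h3 : ¬ 3 ∣ q := fun h => hq3 ((Nat.prime_dvd_prime_iff_eq Nat.prime_three hq).1 h).symm
  have : star om = om ^ 2 := by decide
  rw [this, omSymbol_natCast h3, ← map_pow, ← map_pow, ← map_mul, ← mul_pow, ← sq]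


/-- `X` is a completely multiplicative function which is a cubic character modulo `M` on the
integers prime to `M` and whose value at each rational prime `q ∤ 3M` is the cubic residue symbol
of `α` modulo `q`. -/
structure CubicChar (M : ℤ) (α : Eis) (X : ℤ →* Eis) : Prop where
  cube : ∀ m, IsCoprime m M → X m ^ 3 = 1
  periodic : ∀ a b, IsCoprime a M → M ∣ a - b → X a = X b
  symbol : ∀ (q : ℕ) [Fact q.Prime], q ≠ 3 → ¬ (q : ℤ) ∣ M → HasSymbol q α (X q)

lemma CubicChar.mono {M M' : ℤ} {α : Eis} {X : ℤ →* Eis} (hX : CubicChar M α X) (h : M ∣ M') :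
    CubicChar M' α X where
  cube m hm := hX.cube m (hm.of_isCoprime_of_dvd_right h)
  periodic a b ha hab := hX.periodic a b (ha.of_isCoprime_of_dvd_right h) (h.trans hab)
  symbol q _ hq3 hq := hX.symbol q hq3 fun h' => hq (h'.trans h)

lemma CubicChar.mul {M : ℤ} {α β : Eis} {X Y : ℤ →* Eis} (hX : CubicChar M α X)
    (hY : CubicChar M β Y) : CubicChar M (α * β) (X * Y) where
  cube m hm := by rw [MonoidHom.mul_apply, mul_pow, hX.cube m hm, hY.cube m hm, one_mul]
  periodic a b ha h := by
    rw [MonoidHom.mul_apply, MonoidHom.mul_apply, hX.periodic a b ha h, hY.periodic a b ha h]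
  symbol q _ hq3 hq := by
    rw [MonoidHom.mul_apply]
    exact (hX.symbol q hq3 hq).mul (hY.symbol q hq3 hq)

/-- A rational integer has trivial symbol at all primes. -/
lemma CubicChar.intCast (M m : ℤ) : CubicChar M (m : Eis) 1 where
  cube _ _ := by simp
  periodic _ _ _ _ := rfl
  symbol q _ _ _ := HasSymbol.intCast m

section JacobiSum

variable {l : ℕ} [Fact l.Prime]

lemma star_mulChar_apply {χ : MulChar (ZMod l) Eis} (hχ : χ ^ 3 = 1) (t : ZMod l) :
    star (χ t) = χ⁻¹ t := by
  have hinv : χ⁻¹ = χ ^ 2 := inv_eq_of_mul_eq_one_left (by rw [← pow_succ, hχ])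
  rw [hinv, MulChar.pow_apply' _ two_ne_zero]
  by_cases ht : IsUnit t
  · apply star_eq_sq_of_cube_eq_one
    rw [← MulChar.pow_apply' _ three_ne_zero, hχ, MulChar.one_apply ht]
  · rw [MulChar.map_nonunit _ ht]; simp

lemma star_jacobiSum {χ : MulChar (ZMod l) Eis} (hχ : χ ^ 3 = 1) :
    star (jacobiSum χ χ) = jacobiSum χ⁻¹ χ⁻¹ := by
  simp only [jacobiSum, star_sum, star_mul', star_mulChar_apply hχ]

lemma norm_jacobiSum {χ : MulChar (ZMod l) Eis} (hχ : orderOf χ = 3) :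
    norm (jacobiSum χ χ) = l := by
  have h3 : χ ^ 3 = 1 := hχ ▸ pow_orderOf_eq_one χ
  have h1 : χ ≠ 1 := by rintro rfl; simp at hχ
  have h2 : χ * χ ≠ 1 := fun h => by
    have : orderOf χ ∣ 2 := orderOf_dvd_of_pow_eq_one (by rw [sq, h])
    rw [hχ] at this; revert this; decide
  let ι := algebraMap Eis (FractionRing Eis)
  have hι : Function.Injective ι := IsFractionRing.injective _ _
  have key := jacobiSum_mul_jacobiSum_inv (F := ZMod l) (F' := FractionRing Eis)
    (χ := χ.ringHomComp ι) (φ := χ.ringHomComp ι) ?_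
    ((MulChar.ringHomComp_ne_one_iff hι).2 h1) ((MulChar.ringHomComp_ne_one_iff hι).2 h1)
    (by rw [← MulChar.ringHomComp_mul]; exact (MulChar.ringHomComp_ne_one_iff hι).2 h2)
  · rw [MulChar.ringHomComp_inv, jacobiSum_ringHomComp, jacobiSum_ringHomComp, ← map_mul,
      ← star_jacobiSum h3, mul_star_self, ZMod.card, ← map_natCast ι] at key
    have := congrArg QuadraticAlgebra.re (hι key)
    simpa using this
  · rw [ringChar.eq (ZMod l) l, ringChar.eq_zero]
    exact (Fact.out : l.Prime).ne_zero.symm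

lemma jacobiSum_primary {χ : MulChar (ZMod l) Eis} (hχ : orderOf χ = 3) (hl : l % 3 = 1) :
    3 ∣ (jacobiSum χ χ).re + 1 ∧ 3 ∣ (jacobiSum χ χ).im := by
  have h3 : χ ^ 3 = 1 := hχ ▸ pow_orderOf_eq_one χ
  obtain ⟨z, -, hz⟩ := exists_jacobiSum_eq_neg_one_add (n := 3) (by norm_num) h3 h3
    (by rw [ZMod.card]; omega) om_primitive
  have : (om - 1) ^ 2 = -3 * om := by decide
  rw [hz, this]
  simp

lemma exists_primitive_addChar {q : ℕ} [Fact q.Prime] (hql : q ≠ l) :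
    ∃ ψ : AddChar (ZMod l) (Fbar q), ψ.IsPrimitive := by
  have hl0 : (l : Fbar q) ≠ 0 := by
    rw [Ne, CharP.cast_eq_zero_iff (Fbar q) q]
    exact fun h => hql ((Nat.prime_dvd_prime_iff_eq Fact.out Fact.out).1 h)
  have : NeZero (l : Fbar q) := ⟨hl0⟩
  obtain ⟨ζ, hζ⟩ := IsAlgClosed.exists_root (Polynomial.cyclotomic l (Fbar q))
    (Polynomial.degree_cyclotomic_pos l _ (Fact.out : l.Prime).pos).ne'
  exact ⟨_, AddChar.zmodChar_primitive_of_primitive_root l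
    (Polynomial.isRoot_cyclotomic_iff.1 hζ)⟩

lemma hasSymbol_jacobiSum {χ : MulChar (ZMod l) Eis} (hχ : orderOf χ = 3) {q : ℕ} [Fact q.Prime]
    (hq3 : q ≠ 3) (hql : q ≠ l) : HasSymbol q (jacobiSum χ χ) (χ (q : ZMod l)) := fun φ => by
  have h3 : χ ^ 3 = 1 := hχ ▸ pow_orderOf_eq_one χ
  obtain ⟨ψ, hψ⟩ := exists_primitive_addChar hql
  have hq : q.Prime := Fact.out
  set χ' := χ.ringHomComp φ with hχ'
  set J := jacobiSum χ χ with hJ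
  have hqu : IsUnit (q : ZMod l) := by
    rw [isUnit_iff_ne_zero, Ne, CharP.cast_eq_zero_iff (ZMod l) l]
    exact fun h => hql ((Nat.prime_dvd_prime_iff_eq Fact.out Fact.out).1 h).symm
  have hχq : χ (q : ZMod l) ^ 3 = 1 := by
    rw [← MulChar.pow_apply' _ three_ne_zero, h3, MulChar.one_apply hqu]
  have hord : orderOf χ' = 3 := by
    refine orderOf_eq_prime
      (by rw [hχ', MulChar.ringHomComp_pow, h3, MulChar.ringHomComp_one]) fun h1 => ?_
    have : ∀ t : ZMod l, IsUnit t → χ t = 1 := fun t ht => by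
      refine hom_injOn_cube_roots hq3 φ ?_ (one_pow 3) ?_
      · rw [← MulChar.pow_apply' _ three_ne_zero, h3, MulChar.one_apply ht]
      · have := congrArg (fun f => f t) h1
        simpa [hχ', MulChar.one_apply ht] using this
    have h1 : χ = 1 := MulChar.ext' fun t => by
      by_cases ht : IsUnit t
      · rw [this t ht, MulChar.one_apply ht]
      · rw [MulChar.map_nonunit _ ht, MulChar.map_nonunit _ ht]
    rw [h1] at hχ; simp at hχ
  have h3' : χ' ^ 3 = 1 := hord ▸ pow_orderOf_eq_one χ'
  set g := gaussSum χ' ψ with hg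
  have hneg : χ' (-1) = 1 := by
    have h1 : χ' (-1) ^ 2 = 1 := by rw [← map_pow]; simp
    have h2 : χ' (-1) ^ 3 = 1 := by
      rw [← MulChar.pow_apply' _ three_ne_zero, h3', MulChar.one_apply (by simp)]
    rw [pow_succ, h1, one_mul] at h2; exact h2
  have hcube : g ^ 3 = φ J ^ 2 * φ (star J) := by
    have := gaussSum_pow_eq_prod_jacobiSum (χ := χ') (ψ := ψ) (by rw [hord]; norm_num) hψ
    rw [hord, hneg, ZMod.card] at this
    have hl : ((l : ℕ) : Fbar q) = φ J * φ (star J) := by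
      rw [← map_mul, mul_star_self, norm_jacobiSum hχ]; simp
    rw [hg, this, hl]
    simp only [show Finset.Ico 1 (3 - 1) = {1} by decide, Finset.prod_singleton, pow_one]
    rw [hχ', jacobiSum_ringHomComp]; ring
  have hl0 : ((norm J : ℤ) : Fbar q) ≠ 0 := by
    rw [norm_jacobiSum hχ]
    apply intCast_ne_zero
    exact fun h => hql ((Nat.prime_dvd_prime_iff_eq Fact.out Fact.out).1 (by exact_mod_cast h))
  have hprod : φ J * φ (star J) ≠ 0 := by
    rw [← map_mul, mul_star_self, map_intCast]; exact hl0
  have hJ0 : φ J ≠ 0 := left_ne_zero_of_mul hprod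
  have hg0 : g ≠ 0 := fun h0 => by
    rw [h0, zero_pow three_ne_zero] at hcube
    exact mul_ne_zero hJ0 hprod (by linear_combination -hcube)
  have hchar : χ' ^ (q ^ 2) = χ' := by
    have : 1 ≤ q ^ 2 := Nat.one_le_pow _ _ hq.pos
    conv_lhs => rw [show q ^ 2 = 3 * ((q ^ 2 - 1) / 3) + 1 by rw [three_mul_div hq3]; omega]
    rw [pow_succ, pow_mul, h3', one_pow, one_mul]
  have hfrob : g ^ (q ^ 2) = gaussSum χ' (ψ.mulShift ((q : ZMod l) ^ 2)) := by
    rw [pow_two, pow_mul, hg, gaussSum_frob q, gaussSum_frob q, ← pow_mul, ← pow_mul, ← pow_two,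
      hchar, AddChar.pow_mulShift, Nat.cast_pow]
  have hshift : χ' (q : ZMod l) ^ 2 * g ^ (q ^ 2) = g := by
    have := gaussSum_mulShift χ' ψ (hqu.unit ^ 2)
    rw [Units.val_pow_eq_pow_val, hqu.unit_spec, map_pow] at this
    rw [hfrob]; exact this
  have hχ'q : χ' (q : ZMod l) = φ (χ q) := rfl
  rw [hχ'q] at hshift
  have hone : φ (χ q) ^ 2 * g ^ (3 * ((q ^ 2 - 1) / 3)) = 1 := by
    have : 1 ≤ q ^ 2 := Nat.one_le_pow _ _ hq.pos
    apply mul_right_cancel₀ hg0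
    rw [mul_assoc, ← pow_succ, three_mul_div hq3, Nat.sub_add_cancel this, hshift, one_mul]
  rw [pow_mul, hcube, mul_pow, ← pow_mul] at hone
  have hJ3 := pow_three_mul hq3 _ hJ0 (map_pow_sq hq3 φ J)
  rw [pow_mul'] at hJ3
  rw [pow_mul'] at hone
  have hφ3 : φ (χ q) ^ 3 = 1 := by rw [← map_pow, hχq, map_one]
  set k := (q ^ 2 - 1) / 3
  linear_combination (φ (χ q) * φ J ^ k) * hone - φ (star J) ^ k * hJ3 -
    (φ J ^ k) ^ 3 * φ (star J) ^ k * hφ3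

lemma cubicChar_jacobiSum {χ : MulChar (ZMod l) Eis} (hχ : orderOf χ = 3) :
    ∃ X, CubicChar (norm (jacobiSum χ χ)) (jacobiSum χ χ) X := by
  have h3 : χ ^ 3 = 1 := hχ ▸ pow_orderOf_eq_one χ
  refine ⟨χ.toMonoidHom.comp (Int.castRingHom (ZMod l)).toMonoidHom, ⟨fun m hm => ?_,
    fun a b _ h => ?_, fun q _ hq3 hq => ?_⟩⟩
  · rw [norm_jacobiSum hχ] at hm
    change χ (m : ZMod l) ^ 3 = 1
    have : IsUnit (m : ZMod l) := by
      have := hm.map (Int.castRingHom (ZMod l))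
      simpa using this
    rw [← MulChar.pow_apply' _ three_ne_zero, h3, MulChar.one_apply this]
  · rw [norm_jacobiSum hχ, ← ZMod.intCast_eq_intCast_iff_dvd_sub] at h
    change χ (a : ZMod l) = χ (b : ZMod l)
    rw [h]
  · rw [norm_jacobiSum hχ] at hq
    have hql : q ≠ l := by rintro rfl; exact hq dvd_rfl
    have := hasSymbol_jacobiSum hχ hq3 hql
    change HasSymbol q _ (χ ((q : ℤ) : ZMod l))
    simpa using this

end JacobiSum


lemma dvd_of_dvd_norm {l : ℕ} (hl : l.Prime) (hl3 : l % 3 = 2) {z : Eis} (h : (l : ℤ) ∣ norm z) :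
    (l : ℤ) ∣ z.re ∧ (l : ℤ) ∣ z.im := by
  have : Fact l.Prime := ⟨hl⟩
  rw [norm_eq] at h
  have him : (l : ℤ) ∣ z.im := by
    by_contra him
    rw [← ZMod.intCast_zmod_eq_zero_iff_dvd] at h him
    push_cast at h
    generalize (z.re : ZMod l) = a at h
    generalize (z.im : ZMod l) = b at h him
    have ht : (a / b) ^ 2 - a / b + 1 = 0 := by
      field_simp
      linear_combination h
    generalize a / b = t at ht
    have h3 : t ^ 3 = -1 := by linear_combination (t + 1) * ht
    have h0 : t ≠ 0 := by rintro rfl; simp at ht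
    have h1 := ZMod.pow_card_sub_one_eq_one h0
    obtain ⟨m, hm⟩ : ∃ m, l - 1 = 3 * m + 1 := ⟨l / 3, by omega⟩
    rw [hm, pow_succ, pow_mul, h3] at h1
    have h2 : t ^ 2 = 1 := by
      rcases neg_one_pow_eq_or (ZMod l) m with h | h <;> rw [h] at h1
      · linear_combination (t + 1) * h1
      · linear_combination (1 - t) * h1
    have h4 : t = 2 := by linear_combination h2 - ht
    have h5 : ((3 : ℕ) : ZMod l) = 0 := by
      rw [h4] at h2; push_cast; linear_combination h2
    rw [CharP.cast_eq_zero_iff (ZMod l) l, Nat.prime_dvd_prime_iff_eq hl Nat.prime_three] at h5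
    omega
  refine ⟨?_, him⟩
  have : (l : ℤ) ∣ z.re ^ 2 := by
    obtain ⟨c, hc⟩ := him
    obtain ⟨d, hd⟩ := h
    exact ⟨d + z.re * c - l * c ^ 2, by rw [hc] at hd; linear_combination hd⟩
  exact (Nat.prime_iff_prime_int.1 hl).dvd_of_dvd_pow this

lemma exists_intCast_mul {m : ℤ} {z : Eis} (h1 : m ∣ z.re) (h2 : m ∣ z.im) :
    ∃ γ : Eis, z = (m : Eis) * γ := by
  obtain ⟨c, hc⟩ := h1
  obtain ⟨d, hd⟩ := h2
  exact ⟨⟨c, d⟩, by ext <;> simp [hc, hd]⟩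

lemma dvd_or_star_dvd {l : ℕ} (hl : l.Prime) {J z : Eis} (hJ : norm J = l)
    (h : (l : ℤ) ∣ norm z) : J ∣ z ∨ star J ∣ z := by
  have hp : Prime (l : ℤ) := Nat.prime_iff_prime_int.1 hl
  have hl0 : ((l : ℤ) : Eis) ≠ 0 := by exact_mod_cast hl.ne_zero
  have key : ∀ w : Eis, norm w = l → (l : ℤ) ∣ (z * star w).im → w ∣ z := by
    intro w hw him
    have hre : (l : ℤ) ∣ (z * star w).re := by
      have hn : (l : ℤ) ∣ norm (z * star w) := by
        rw [map_mul]; exact h.mul_right _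
      rw [norm_eq] at hn
      apply hp.dvd_of_dvd_pow (n := 2)
      have h1 := (dvd_sub hn (him.mul_right (z * star w).im)).add (him.mul_right (z * star w).re)
      convert h1 using 1; ring
    obtain ⟨γ, hγ⟩ := exists_intCast_mul hre him
    refine ⟨γ, mul_right_cancel₀ hl0 ?_⟩
    have hww := mul_star_self w
    rw [hw] at hww
    linear_combination w * hγ - z * hww
  have hprod : (l : ℤ) ∣ (z * star J).im * (z * star (star J)).im := by
    have : (z * star J).im * (z * star (star J)).im = z.im ^ 2 * norm J - J.im ^ 2 * norm z := by
      rw [star_star, norm_eq, norm_eq]; simp; ring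
    rw [this, hJ]
    exact dvd_sub (Dvd.intro_left _ rfl) (h.mul_left _)
  rcases hp.dvd_or_dvd hprod with h | h
  · exact .inl (key J hJ h)
  · refine .inr (key (star J) ?_ h)
    rw [QuadraticAlgebra.norm_star, hJ]

/-- An Eisenstein integer that is congruent to `±1` modulo `3`. -/
def IsPrimary (z : Eis) : Prop := ¬ (3 : ℤ) ∣ z.re ∧ (3 : ℤ) ∣ z.im

lemma exists_primary_prime {l : ℕ} (hl : l.Prime) (hl3 : l % 3 = 1) :
    ∃ J : Eis, norm J = l ∧ IsPrimary J ∧ (∃ X, CubicChar (norm J) J X) ∧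
      ∃ X, CubicChar (norm J) (star J) X := by
  have : Fact l.Prime := ⟨hl⟩
  obtain ⟨χ, hχ⟩ := MulChar.exists_mulChar_orderOf (ZMod l) (n := 3)
    (by rw [ZMod.card]; omega) om_primitive
  have hχ' : orderOf χ⁻¹ = 3 := by rw [orderOf_inv, hχ]
  have h3 : χ ^ 3 = 1 := hχ ▸ pow_orderOf_eq_one χ
  obtain ⟨h1, h2⟩ := jacobiSum_primary hχ hl3
  refine ⟨_, norm_jacobiSum hχ, ⟨by omega, h2⟩, cubicChar_jacobiSum hχ, ?_⟩
  rw [norm_jacobiSum hχ, ← norm_jacobiSum hχ', star_jacobiSum h3]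
  exact cubicChar_jacobiSum hχ'

lemma IsPrimary.star {z : Eis} (h : IsPrimary z) : IsPrimary (star z) := by
  obtain ⟨h1, h2⟩ := h
  constructor <;> simp <;> omega

lemma IsPrimary.of_mul {z w : Eis} (hz : IsPrimary z) (h : IsPrimary (z * w)) : IsPrimary w := by
  obtain ⟨h1, c, hc⟩ := hz
  obtain ⟨h2, h3⟩ := h
  simp only [re_mul, im_mul, hc] at h2 h3
  constructor
  · intro hw
    apply h2
    obtain ⟨d, hd⟩ := hw
    exact ⟨z.re * d - c * w.im, by rw [hd]; ring⟩
  · have : (3 : ℤ) ∣ z.re * w.im := by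
      obtain ⟨d, hd⟩ := h3
      exact ⟨d - c * w.re + c * w.im, by linear_combination hd⟩
    exact (Int.prime_three.dvd_or_dvd this).resolve_left h1

/-- Cubic reciprocity between primary Eisenstein integers and rational primes. -/
theorem exists_cubicChar_of_primary (z : Eis) (hz : IsPrimary z) :
    ∃ X, CubicChar (norm z) z X := by
  induction hn : (norm z).toNat using Nat.strong_induction_on generalizing z with
  | _ n ih =>
  have hpos : 0 < norm z := by
    refine lt_of_le_of_ne (norm_nonneg z) fun h => ?_
    rw [eq_comm, norm_eq_zero] at h
    exact hz.1 (by simp [h])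
  have hstep : ∀ w γ : Eis, IsPrimary w → 1 < norm w → (∃ X, CubicChar (norm w) w X) →
      z = w * γ → ∃ X, CubicChar (norm z) z X := by
    rintro w γ hw hw1 ⟨X, hX⟩ rfl
    rw [map_mul] at hpos hn ⊢
    have hγ : 0 < norm γ := pos_of_mul_pos_right hpos (by omega)
    obtain ⟨Y, hY⟩ := ih (norm γ).toNat (by
      have : norm γ < norm w * norm γ := by nlinarith
      omega) γ (hw.of_mul hz) rfl
    exact ⟨X * Y, (hX.mono (Dvd.intro _ rfl)).mul (hY.mono (Dvd.intro_left _ rfl))⟩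
  by_cases h1 : norm z = 1
  · obtain ⟨hre, c, hc⟩ := hz
    have hi : z.im = 0 := by
      rw [norm_eq] at h1
      have h4 : (2 * z.re - z.im) ^ 2 + 3 * z.im ^ 2 = 4 := by linear_combination 4 * h1
      rw [hc] at h4 ⊢
      have : c = 0 := by
        by_contra hc0
        have : 1 ≤ c ^ 2 := by
          have := sq_pos_of_ne_zero hc0; omega
        nlinarith [sq_nonneg (2 * z.re - 3 * c)]
      rw [this, mul_zero]
    have : z = (z.re : Eis) := by ext <;> simp [hi]
    rw [this]
    exact ⟨1, CubicChar.intCast _ _⟩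
  · obtain ⟨l, hl, hlz⟩ := Nat.exists_prime_and_dvd (n := (norm z).toNat) (by omega)
    have hlz' : (l : ℤ) ∣ norm z := by
      have := Int.natCast_dvd_natCast.2 hlz
      rwa [Int.toNat_of_nonneg hpos.le] at this
    have hl3 : l ≠ 3 := by
      rintro rfl
      obtain ⟨h2, h3⟩ := hz
      rw [norm_eq] at hlz'
      have : (3 : ℤ) ∣ z.re ^ 2 := by
        obtain ⟨c, hc⟩ := h3
        obtain ⟨d, hd⟩ := hlz'
        exact ⟨d + z.re * c - 3 * c ^ 2, by rw [hc] at hd; push_cast at hd; linear_combination hd⟩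
      exact h2 (Int.prime_three.dvd_of_dvd_pow this)
    have hmod : l % 3 = 1 ∨ l % 3 = 2 := by
      have : ¬ 3 ∣ l := fun h => hl3 ((Nat.prime_dvd_prime_iff_eq Nat.prime_three hl).1 h).symm
      omega
    have hl1 : (1 : ℤ) < l := by exact_mod_cast hl.one_lt
    rcases hmod with hmod | hmod
    · obtain ⟨J, hJ, hJp, hX, hY⟩ := exists_primary_prime hl hmod
      rcases dvd_or_star_dvd hl hJ hlz' with ⟨γ, hγ⟩ | ⟨γ, hγ⟩
      · exact hstep J γ hJp (by rw [hJ]; exact hl1) hX hγ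
      · have hs : norm (star J) = norm J := QuadraticAlgebra.norm_star J
        refine hstep (star J) γ hJp.star (by rw [hs, hJ]; exact hl1) ?_ hγ
        rw [hs]; exact hY
    · obtain ⟨h2, h3⟩ := dvd_of_dvd_norm hl hmod hlz'
      obtain ⟨γ, hγ⟩ := exists_intCast_mul h2 h3
      refine hstep ((l : ℤ) : Eis) γ ⟨?_, ?_⟩ ?_ ⟨1, CubicChar.intCast _ _⟩ hγ
      · simp only [re_intCast, Int.cast_id]; omega
      · simp
      · rw [QuadraticAlgebra.norm_intCast, Int.cast_id]; nlinarith

lemma cubicChar_om : CubicChar 9 om omSymbol where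
  cube m hm := by
    rw [omSymbol_apply]
    obtain ⟨a, b, hab⟩ := hm
    have h := congrArg (Int.cast : ℤ → ZMod 9) hab
    push_cast at h
    have h9 : (9 : ZMod 9) = 0 := by decide
    rw [h9, mul_zero, add_zero] at h
    have : ∀ x y : ZMod 9, x * y = 1 → omChar y ^ 3 = 1 := by decide
    exact this _ _ h
  periodic a b _ h := by
    rw [omSymbol_apply, omSymbol_apply]
    have : (b : ZMod 9) = (a : ZMod 9) := (ZMod.intCast_eq_intCast_iff_dvd_sub b a 9).2 h
    rw [this]
  symbol q _ hq3 _ := hasSymbol_om hq3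

lemma cubicChar_sqrtNegThree (M : ℤ) : CubicChar M sqrtNegThree 1 where
  cube _ _ := by simp
  periodic _ _ _ _ := rfl
  symbol _ _ _ _ := HasSymbol.sqrtNegThree

/-- Cubic reciprocity between arbitrary Eisenstein integers and rational primes, at the price of
enlarging the modulus by a factor `9`. -/
theorem exists_cubicChar (z : Eis) (hz : z ≠ 0) : ∃ X, CubicChar (9 * norm z) z X := by
  induction hn : (norm z).toNat using Nat.strong_induction_on generalizing z with
  | _ n ih =>
  by_cases h3 : (3 : ℤ) ∣ z.re + z.im
  · obtain ⟨c, hc⟩ := h3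
    obtain ⟨γ, hγ⟩ : sqrtNegThree ∣ z := ⟨⟨z.im - c, z.im - 2 * c⟩, by
      ext
      · simp; linarith
      · simp; linarith⟩
    have hγ0 : γ ≠ 0 := by rintro rfl; simp at hγ; exact hz hγ
    have hnz : norm z = 3 * norm γ := by
      rw [hγ, map_mul]; congr 1
    have hpos : 0 < norm γ := lt_of_le_of_ne (norm_nonneg γ) fun h => hγ0 (norm_eq_zero.1 h.symm)
    obtain ⟨Y, hY⟩ := ih (norm γ).toNat (by omega) γ hγ0 rfl
    refine ⟨1 * Y, ?_⟩
    rw [hnz]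
    rw [hγ]
    exact (cubicChar_sqrtNegThree _).mul (hY.mono ⟨3, by ring⟩)
  · have key : ∀ w v : Eis, norm w = norm z → IsPrimary w → z = v * w →
        (∃ X, CubicChar (9 * norm z) v X) → ∃ X, CubicChar (9 * norm z) z X := by
      rintro w v hw hwp hz ⟨X, hX⟩
      obtain ⟨Y, hY⟩ := exists_cubicChar_of_primary w hwp
      rw [hw] at hY
      refine ⟨X * Y, ?_⟩
      have := hX.mul (hY.mono (Dvd.intro_left 9 rfl))
      rwa [← hz] at this
    have hom : CubicChar (9 * norm z) om omSymbol := cubicChar_om.mono (Dvd.intro _ rfl)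
    have h : (3 : ℤ) ∣ z.im ∨ (3 : ℤ) ∣ z.re ∨ (3 : ℤ) ∣ z.re - z.im := by
      have h1 : z.re % 3 = 0 ∨ z.re % 3 = 1 ∨ z.re % 3 = 2 := by omega
      have h2 : z.im % 3 = 0 ∨ z.im % 3 = 1 ∨ z.im % 3 = 2 := by omega
      rcases h1 with h1 | h1 | h1 <;> rcases h2 with h2 | h2 | h2 <;> omega
    rcases h with h | h | h
    · exact key z 1 rfl ⟨by omega, h⟩ (one_mul z).symm ⟨1, by simpa using CubicChar.intCast _ 1⟩
    · refine key (om ^ 2 * z) om ?_ ?_ ?_ ⟨_, hom⟩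
      · rw [map_mul]; exact one_mul _
      · have : om ^ 2 = ⟨-1, -1⟩ := by decide
        rw [this]
        constructor <;> simp <;> omega
      · rw [← mul_assoc, ← pow_succ', om_cube, one_mul]
    · refine key (om * z) (om * om) ?_ ?_ ?_ ⟨_, hom.mul hom⟩
      · rw [map_mul]; exact one_mul _
      · constructor <;> simp <;> omega
      · rw [← mul_assoc, ← pow_three', om_cube, one_mul]

lemma monoidHom_eq_of_forall_prime {R : Type*} [CommMonoid R] {f g : ℤ →* R}
    (hf : f (-1) = 1) (hg : g (-1) = 1) {m : ℤ} (hm : m ≠ 0)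
    (h : ∀ q : ℕ, q.Prime → (q : ℤ) ∣ m → f q = g q) : f m = g m := by
  have key : ∀ n : ℕ, n ≠ 0 → (∀ q : ℕ, q.Prime → q ∣ n → f q = g q) → f n = g n := by
    intro n
    induction n using induction_on_primes with
    | zero => simp
    | one => simp
    | prime_mul q a hq ih =>
      intro h0 h
      push_cast
      rw [map_mul, map_mul, h q hq (dvd_mul_right _ _),
        ih (right_ne_zero_of_mul h0) fun r hr hra => h r hr (hra.mul_left q)]
  have hn := key m.natAbs (Int.natAbs_ne_zero.2 hm) fun q hq hqm =>
    h q hq (Int.natCast_dvd.2 hqm)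
  rcases Int.natAbs_eq m with hm | hm <;> rw [hm]
  · exact hn
  · rw [← neg_one_mul, map_mul, map_mul, hf, hg, hn]

namespace HasSymbol

variable {q : ℕ} [Fact q.Prime] {α : Eis}

lemma of_dvd_im (h : (q : ℤ) ∣ α.im) : HasSymbol q α 1 := by
  obtain ⟨t, ht⟩ := h
  have : α = (α.re : Eis) + (q : Eis) * ⟨0, t⟩ := by ext <;> simp [ht]
  rw [this]
  exact (intCast _).congr_of_dvd _

lemma of_dvd_trace (h : (q : ℤ) ∣ 2 * α.re - α.im) : HasSymbol q α 1 := by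
  obtain ⟨t, ht⟩ := h
  have : α = (α.re : Eis) * Eis.sqrtNegThree + (q : Eis) * ⟨0, -t⟩ := by
    ext
    · simp
    · simp; linarith
  rw [this]
  exact (sqrtNegThree.intCast_mul _).congr_of_dvd _

lemma of_dvd_re (hq3 : q ≠ 3) (h : (q : ℤ) ∣ α.re) : HasSymbol q α (omSymbol q) := by
  obtain ⟨t, ht⟩ := h
  have : α = (α.im : Eis) * om + (q : Eis) * ⟨t, 0⟩ := by ext <;> simp [ht]
  rw [this]
  exact ((hasSymbol_om hq3).intCast_mul _).congr_of_dvd _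

lemma of_dvd_im_sub_re (hq3 : q ≠ 3) (h : (q : ℤ) ∣ α.im - α.re) :
    HasSymbol q α (omSymbol q ^ 2) := by
  obtain ⟨t, ht⟩ := h
  have : α = ((-α.re : ℤ) : Eis) * (om * om) + (q : Eis) * ⟨0, t⟩ := by
    ext
    · simp
    · simp; linarith
  rw [this, pow_two]
  exact (((hasSymbol_om hq3).mul (hasSymbol_om hq3)).intCast_mul _).congr_of_dvd _

end HasSymbol

lemma not_natCast_dvd_of_isCoprime {q : ℕ} (hq : q.Prime) {m M : ℤ} (h : IsCoprime m M)
    (hm : (q : ℤ) ∣ m) : ¬ (q : ℤ) ∣ M := fun hM =>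
  (Nat.prime_iff_prime_int.1 hq).not_isUnit (h.isUnit_of_dvd' hm hM)

lemma omSymbol_neg_one : omSymbol (-1) = 1 := by decide

namespace CubicChar

variable {M : ℤ} {α : Eis} {X : ℤ →* Eis}

lemma map_neg_one (hX : CubicChar M α X) : X (-1) = 1 := by
  have h3 := hX.cube (-1) isCoprime_one_left.neg_left
  have h2 : X (-1) ^ 2 = 1 := by rw [← map_pow]; simp
  rwa [pow_succ, h2, one_mul] at h3

lemma map_eq (hX : CubicChar M α X) (hN : norm α ∣ M) {Y : ℤ →* Eis} (hY : Y (-1) = 1) {m : ℤ}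
    (hm : m ≠ 0) (hmM : IsCoprime m M) (h3 : (3 : ℤ) ∣ m → X 3 = Y 3)
    (h : ∀ (q : ℕ) [Fact q.Prime], q ≠ 3 → (q : ℤ) ∣ m → HasSymbol q α (Y q) ∧ Y q ^ 3 = 1) :
    X m = Y m := by
  refine monoidHom_eq_of_forall_prime hX.map_neg_one hY hm fun q hq hqm => ?_
  by_cases hq3 : q = 3
  · subst hq3; exact h3 hqm
  · have : Fact q.Prime := ⟨hq⟩
    have hqM := not_natCast_dvd_of_isCoprime hq hmM hqm
    obtain ⟨h1, h2⟩ := h q hq3 hqm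
    exact HasSymbol.unique hq3 (fun h => hqM (h.trans hN))
      (hX.cube _ (hmM.of_isCoprime_of_dvd_left hqm)) h2 (hX.symbol q hq3 hqM) h1

lemma map_eq_one (hX : CubicChar M α X) (hN : norm α ∣ M) {m : ℤ}
    (hmM : IsCoprime m M) (h3 : (3 : ℤ) ∣ m → X 3 = 1)
    (h : ∀ (q : ℕ) [Fact q.Prime], q ≠ 3 → (q : ℤ) ∣ m → HasSymbol q α 1) : X m = 1 := by
  by_cases hm : m = 0
  · have hM : IsUnit M := isCoprime_zero_left.1 (hm ▸ hmM)
    rw [hX.periodic m 1 hmM (hM.dvd), map_one]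
  · exact hX.map_eq hN (Y := 1) rfl hm hmM h3 fun q _ hq3 hqm => ⟨h q hq3 hqm, one_pow 3⟩

/-- The supplementary law for the prime `3`. -/
theorem map_three (hX : CubicChar (norm α) α X) (hα : IsCoprime α.re α.im)
    (hre : ¬ (3 : ℤ) ∣ α.re) (him : (9 : ℤ) ∣ α.im) : X 3 = 1 := by
  obtain ⟨c, d⟩ := α
  simp only at hα hre him
  set N := norm (⟨c, d⟩ : Eis) with hN
  have hNe : N = c ^ 2 - c * d + d ^ 2 := norm_eq _
  have h3c : IsCoprime 3 c := (Int.prime_three.coprime_iff_not_dvd).2 hre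
  by_cases hd0 : d = 0
  · subst hd0
    have hc : IsUnit c := isCoprime_zero_right.1 hα
    have hN1 : N = 1 := by
      rcases Int.isUnit_iff.1 hc with h | h <;> rw [hNe, h] <;> norm_num
    rw [← map_one X]
    exact hX.periodic _ _ (by rw [hN1]; exact isCoprime_one_right) (by rw [hN1]; exact one_dvd _)
  obtain ⟨e, he⟩ := him
  have hcN : IsCoprime c N := by
    have : N = d ^ 2 + c * (c - d) := by rw [hNe]; ring
    rw [this]
    exact (hα.pow_right).add_mul_left_right _
  have hdN : IsCoprime d N := by
    have : N = c ^ 2 + d * (d - c) := by rw [hNe]; ring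
    rw [this]
    exact (hα.symm.pow_right).add_mul_left_right _
  have h3N : IsCoprime 3 N := hdN.of_isCoprime_of_dvd_left ⟨3 * e, by rw [he]; ring⟩
  have hdc : IsCoprime (d - c) N := by
    have : N = c ^ 2 + (d - c) * d := by rw [hNe]; ring
    rw [this]
    refine IsCoprime.add_mul_left_right (IsCoprime.pow_right ?_) _
    have := hα.symm.add_mul_right_left (-1)
    rwa [neg_one_mul, ← sub_eq_add_neg] at this
  have htN : IsCoprime (2 * c - d) N := by
    have h2 : IsCoprime 2 N := by
      refine Int.prime_two.coprime_iff_not_dvd.2 fun h2 => ?_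
      have h2d : ¬ (2 : ℤ) ∣ d := fun h => Int.prime_two.not_isUnit (hdN.isUnit_of_dvd' h h2)
      have h2c : ¬ (2 : ℤ) ∣ c := fun h => Int.prime_two.not_isUnit (hcN.isUnit_of_dvd' h h2)
      obtain ⟨a, ha⟩ : ∃ a, c = 2 * a + 1 := ⟨c / 2, by omega⟩
      obtain ⟨b, hb⟩ : ∃ b, d = 2 * b + 1 := ⟨d / 2, by omega⟩
      obtain ⟨t, ht⟩ := h2
      rw [hNe, ha, hb] at ht
      ring_nf at ht
      omega
    have h := ((h3N.mul_left (hdN.pow_left (m := 2))).neg_left).add_mul_right_left 4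
    have h' : -(3 * d ^ 2) + 4 * N = (2 * c - d) ^ 2 := by rw [hNe]; ring
    rw [h'] at h
    exact (IsCoprime.pow_left_iff two_pos).1 h
  obtain ⟨k, d', hd', hdk⟩ : ∃ k d', ¬ (3 : ℤ) ∣ d' ∧ d = 3 ^ k * d' := by
    obtain ⟨d', h1, h2⟩ := (Int.finiteMultiplicity_iff.2 ⟨by norm_num, hd0⟩ :
      FiniteMultiplicity (3 : ℤ) d).exists_eq_pow_mul_and_not_dvd
    exact ⟨_, d', h2, h1⟩
  have hd'd : d' ∣ d := Dvd.intro_left _ hdk.symm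
  have hXd : X d = X 3 ^ k := by
    rw [hdk, map_mul, map_pow, hX.map_eq_one dvd_rfl
      (hdN.of_isCoprime_of_dvd_left hd'd) (fun h => absurd h hd')
      (fun q _ _ hq => HasSymbol.of_dvd_im (hq.trans hd'd)), mul_one]
  have hXt : X (2 * c - d) = 1 :=
    hX.map_eq_one dvd_rfl htN (fun h => absurd h (by omega))
      fun q _ _ hq => HasSymbol.of_dvd_trace hq
  have hom : ∀ m : ℤ, ¬ (3 : ℤ) ∣ m → omSymbol m ^ 3 = 1 := fun m hm =>
    cubicChar_om.cube m ((Int.prime_three.coprime_iff_not_dvd.2 hm).symm.pow_right (n := 2))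
  have hne : ∀ m : ℤ, ¬ (3 : ℤ) ∣ m → ∀ (q : ℕ) [Fact q.Prime], (q : ℤ) ∣ m →
      omSymbol q ^ 3 = 1 := fun m hm q _ hq => hom q fun h => hm (h.trans hq)
  have hXc : X c = omSymbol c :=
    hX.map_eq dvd_rfl omSymbol_neg_one (by rintro rfl; simp at hre) hcN (fun h => absurd h hre)
      fun q _ hq3 hq => ⟨HasSymbol.of_dvd_re hq3 hq, hne c hre q hq⟩
  have hdc3 : ¬ (3 : ℤ) ∣ d - c := by omega
  have hXdc : X (d - c) = omSymbol (d - c) ^ 2 := by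
    refine hX.map_eq dvd_rfl (Y := omSymbol ^ 2) ?_ (by omega) hdc (fun h => absurd h hdc3)
      fun q _ hq3 hq => ⟨HasSymbol.of_dvd_im_sub_re hq3 hq, ?_⟩
    · rw [MonoidHom.pow_apply, omSymbol_neg_one, one_pow]
    · rw [MonoidHom.pow_apply, ← pow_mul, mul_comm, pow_mul, hne _ hdc3 q hq, one_pow]
  have homc : omSymbol (d - c) = omSymbol c := by
    have h9 : IsCoprime (d - c) 9 :=
      (Int.prime_three.coprime_iff_not_dvd.2 hdc3).symm.pow_right (n := 2)
    rw [cubicChar_om.periodic (d - c) (-1 * c) h9 ⟨e, by rw [he]; ring⟩, map_mul,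
      omSymbol_neg_one, one_mul]
  have h1 : X ((2 * c - d) ^ 2) = X (-1 * (3 * d ^ 2)) :=
    hX.periodic _ _ htN.pow_left ⟨4, by rw [hNe]; ring⟩
  have h2 : X (d * (d - c)) = X (-1 * c ^ 2) :=
    hX.periodic _ _ (hdN.mul_left hdc) ⟨1, by rw [hNe]; ring⟩
  rw [map_pow, hXt, map_mul, hX.map_neg_one, map_mul, map_pow, hXd] at h1
  rw [map_mul, map_mul, hX.map_neg_one, map_pow, hXd, hXdc, hXc, homc] at h2
  have hk : X 3 ^ k = 1 := by
    linear_combination omSymbol c * h2 + (1 - X 3 ^ k) * hom c hre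
  rw [hk] at h1
  linear_combination -h1

end CubicChar

lemma exists_mul_isCoprime (m n : ℤ) : ∃ g m' n', m = g * m' ∧ n = g * n' ∧ IsCoprime m' n' := by
  obtain ⟨m', n', hm, hn, h⟩ := extract_gcd m n
  exact ⟨_, m', n', hm, hn, (gcd_isUnit_iff m' n').1 h⟩

/-- The primitive Eisenstein integer underlying `e + f * √-3`. -/
lemma exists_primitive {e f : ℤ} (h : IsCoprime e f) : ∃ (α : Eis) (m : ℤ),
    (e : Eis) + (f : Eis) * sqrtNegThree = m * α ∧ IsCoprime α.re α.im ∧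
    norm α ∣ e ^ 2 + 3 * f ^ 2 ∧ f ∣ α.im ∧ e ∣ 2 * α.re - α.im ∧
    (¬ (2 : ℤ) ∣ e ^ 2 + 3 * f ^ 2 → (2 : ℤ) ∣ α.im) := by
  have hef : IsCoprime (e + f) f := by simpa using h.add_mul_left_left 1
  by_cases h2 : (2 : ℤ) ∣ e + f
  · obtain ⟨t, ht⟩ := h2
    have hN : e ^ 2 + 3 * f ^ 2 = norm (⟨t, f⟩ : Eis) * 4 := by
      rw [norm_eq]; linear_combination (e - f + 2 * t) * ht
    refine ⟨⟨t, f⟩, 2, ?_, ?_, ⟨4, hN⟩, dvd_rfl, ⟨1, ?_⟩, fun h => absurd ?_ h⟩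
    · ext
      · simpa using ht
      · simp; ring
    · exact (ht ▸ hef).of_mul_left_right
    · simp only; linarith
    · rw [hN]; exact (by norm_num : (2 : ℤ) ∣ 4).mul_left _
  · refine ⟨⟨e + f, 2 * f⟩, 1, ?_, ?_, dvd_of_eq ?_, Dvd.intro_left 2 rfl, ⟨2, ?_⟩, fun _ =>
      Dvd.intro _ rfl⟩
    · ext
      · simp
      · simp; ring
    · exact (Int.prime_two.coprime_iff_not_dvd.2 h2).symm.mul_right hef
    · rw [norm_eq]; ring
    · simp only; ring

lemma isCoprime_three {m : ℤ} (h : ¬ (3 : ℤ) ∣ m) : IsCoprime m 3 :=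
  (Int.prime_three.coprime_iff_not_dvd.2 h).symm

/-- If `p = x ^ 2 + 27 * c ^ 2 * D`, where `c` is divisible by sufficiently many of the prime
factors of `G` and `G ^ 2 * (A ^ 2 - B ^ 2 * D)` is a cube, then `B * x + 3 * A * c * √-3` has
trivial cubic residue symbol modulo `p`. -/
theorem hasSymbol_of_eq_add {A B D G n c x : ℤ} {p : ℕ} [hp : Fact p.Prime] (hp3 : p % 3 = 1)
    (hAB : IsCoprime A B) (hrep : (p : ℤ) = x ^ 2 + 27 * c ^ 2 * D)
    (hn : G ^ 2 * (A ^ 2 - B ^ 2 * D) = n ^ 3) (hxc : IsCoprime x (3 * c * D))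
    (hpN : ¬ (p : ℤ) ∣ A ^ 2 - B ^ 2 * D)
    (hG : ∀ q : ℕ, q.Prime → (q : ℤ) ∣ G →
      (q : ℤ) ∣ A ^ 2 - B ^ 2 * D ∧ (q ≠ 2 → ¬ (q : ℤ) ∣ D → (q : ℤ) ∣ c)) :
    HasSymbol p (((B * x : ℤ) : Eis) + ((3 * A * c : ℤ) : Eis) * sqrtNegThree) 1 := by
  have hp' : Prime (p : ℤ) := Nat.prime_iff_prime_int.1 hp.out
  have hx3 : IsCoprime x 3 := hxc.of_mul_right_left.of_mul_right_left
  have hxc' : IsCoprime x c := hxc.of_mul_right_left.of_mul_right_right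
  have hxD : IsCoprime x D := hxc.of_mul_right_right
  have hpx : ¬ (p : ℤ) ∣ x := by
    intro h
    have : IsCoprime x p := by
      have h := (((hx3.pow_right (n := 3)).mul_right (hxc'.pow_right (n := 2))).mul_right
        hxD).add_mul_left_right x
      have h' : 3 ^ 3 * c ^ 2 * D + x * x = p := by rw [hrep]; ring
      rwa [h'] at h
    exact hp'.not_isUnit (this.isUnit_of_dvd' h dvd_rfl)
  obtain ⟨g, b, w, hB, hw, hbw⟩ := exists_mul_isCoprime B (3 * c)
  obtain ⟨h, x', a, hx, hA, hxa⟩ := exists_mul_isCoprime x A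
  have hx'x : x' ∣ x := Dvd.intro_left _ hx.symm
  have hef : IsCoprime (b * x') (a * w) := by
    refine IsCoprime.mul_left (.mul_right ?_ hbw) (.mul_right hxa ?_)
    · exact hAB.symm.mono (Dvd.intro_left _ hB.symm) (Dvd.intro_left _ hA.symm)
    · exact (hx3.mul_right hxc').mono hx'x (Dvd.intro_left _ hw.symm)
  obtain ⟨α, m, hα, hαc, hαN, hfα, heα, h2α⟩ := exists_primitive hef
  set e := b * x' with he
  set f := a * w with hf
  set N := e ^ 2 + 3 * f ^ 2 with hN
  set N' := A ^ 2 - B ^ 2 * D with hN'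
  have key : a ^ 2 * p = x' ^ 2 * N' + N * (D * g ^ 2) := by
    rw [hrep, hN', hN, he, hf]
    have : 27 * c ^ 2 = 3 * (g * w) ^ 2 := by rw [← hw]; ring
    rw [this, hx, hA, hB]; ring
  have haN : IsCoprime N a := by
    have h1 : IsCoprime a e := (hef.of_mul_right_left).symm
    have h2 := (h1.pow_right (n := 2)).add_mul_left_right (3 * a * w ^ 2)
    have h3 : e ^ 2 + a * (3 * a * w ^ 2) = N := by rw [hN, hf]; ring
    exact (h3 ▸ h2).symm
  have hxN : IsCoprime N x' := by
    have h1 : IsCoprime x' f := hef.of_mul_left_right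
    have h2 := ((hx3.of_isCoprime_of_dvd_left hx'x).mul_right
      (h1.pow_right (n := 2))).add_mul_left_right (x' * b ^ 2)
    have h3 : 3 * f ^ 2 + x' * (x' * b ^ 2) = N := by rw [hN, he]; ring
    exact (h3 ▸ h2).symm
  have hpN' : IsCoprime N p := by
    rw [isCoprime_comm, hp'.coprime_iff_not_dvd]
    intro h
    have h1 : (p : ℤ) ∣ x' ^ 2 * N' :=
      (dvd_add_left (h.mul_right (D * g ^ 2))).1 (key ▸ Dvd.intro_left _ rfl)
    rcases hp'.dvd_or_dvd h1 with h1 | h1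
    · exact hpx ((hp'.dvd_of_dvd_pow h1).trans hx'x)
    · exact hpN h1
  have hNN' : IsCoprime N N' := by
    have h1 := ((haN.pow_right (n := 2)).mul_right hpN').add_mul_left_right (-(D * g ^ 2))
    have h2 : a ^ 2 * p + N * -(D * g ^ 2) = x' ^ 2 * N' := by rw [key]; ring
    rw [h2] at h1
    exact h1.of_mul_right_right
  have hGN' : ∀ q : ℕ, q.Prime → (q : ℤ) ∣ G → (q : ℤ) ∣ D → (q : ℤ) ∣ a := by
    intro q hq hqG hqD
    have hq' := Nat.prime_iff_prime_int.1 hq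
    have hqA : (q : ℤ) ∣ A := by
      apply hq'.dvd_of_dvd_pow (n := 2)
      have : A ^ 2 = N' + B ^ 2 * D := by rw [hN']; ring
      rw [this]
      exact (hG q hq hqG).1.add (hqD.mul_left _)
    rw [hA] at hqA
    refine (hq'.dvd_or_dvd hqA).resolve_left fun hqh => ?_
    exact hq'.not_isUnit (hxD.isUnit_of_dvd' (hqh.trans (Dvd.intro _ hx.symm)) hqD)
  have hGB : ∀ q : ℕ, q.Prime → (q : ℤ) ∣ G → ¬ (q : ℤ) ∣ B := by
    intro q hq hqG hqB
    have hq' := Nat.prime_iff_prime_int.1 hq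
    have hqA : (q : ℤ) ∣ A := by
      apply hq'.dvd_of_dvd_pow (n := 2)
      have : A ^ 2 = N' + B * (B * D) := by rw [hN']; ring
      rw [this]
      exact (hG q hq hqG).1.add (hqB.mul_right _)
    exact hq'.not_isUnit (hAB.isUnit_of_dvd' hqA hqB)
  have hN0 : N ≠ 0 := fun h => hp'.not_isUnit (isCoprime_zero_left.1 (h ▸ hpN'))
  have hGN : IsCoprime N G := by
    refine isCoprime_of_prime_dvd (fun h => hN0 h.1) fun z hz hzN hzG => hz.not_isUnit ?_
    have hzN' := (hG z.natAbs (Int.prime_iff_natAbs_prime.1 hz) (Int.natAbs_dvd.2 hzG)).1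
    exact hNN'.isUnit_of_dvd' hzN (Int.natAbs_dvd.1 hzN')
  have core : ∀ (M : ℤ) (X : ℤ →* Eis), CubicChar M α X → norm α ∣ M → M ∣ N * (D * g ^ 2) →
      IsCoprime a M → IsCoprime x' M → IsCoprime G M → IsCoprime N' M → IsCoprime (p : ℤ) M →
      ((3 : ℤ) ∣ a ∨ (3 : ℤ) ∣ G → X 3 = 1) → HasSymbol p α 1 := by
    intro M X hX hαM hM haM hxM hGM hN'M hpM h3
    have hXa : X a = 1 := hX.map_eq_one hαM haM (fun h => h3 (.inl h)) fun q _ _ hq =>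
      HasSymbol.of_dvd_im ((hq.mul_right w).trans hfα)
    have hXx : X x' = 1 := hX.map_eq_one hαM hxM
      (fun h => absurd (hx3.isUnit_of_dvd' (h.trans hx'x) dvd_rfl) Int.prime_three.not_isUnit)
      fun q _ _ hq => HasSymbol.of_dvd_trace ((hq.mul_left b).trans heα)
    have hXG : X G = 1 := by
      refine hX.map_eq_one hαM hGM (fun h => h3 (.inr h)) fun q hq hq3 hqG =>
        HasSymbol.of_dvd_im ?_
      have hq' := Nat.prime_iff_prime_int.1 hq.out
      by_cases hqD : (q : ℤ) ∣ D
      · exact ((hGN' q hq.out hqG hqD).mul_right w).trans hfα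
      by_cases hq2 : q = 2
      · subst hq2
        refine h2α fun h => ?_
        exact hq'.not_isUnit (hNN'.isUnit_of_dvd' h (hG 2 hq.out hqG).1)
      · have hqw : (q : ℤ) ∣ g * w := hw ▸ ((hG q hq.out hqG).2 hq2 hqD).mul_left 3
        refine ((hq'.dvd_or_dvd hqw).resolve_left fun h => ?_).mul_left a |>.trans hfα
        exact hGB q hq.out hqG (h.trans (Dvd.intro _ hB.symm))
    have hn' : IsCoprime n M := by
      have := (hGM.pow_left (m := 2)).mul_left hN'M
      rw [hn] at this
      exact (IsCoprime.pow_left_iff three_pos).1 this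
    have hXN : X N' = 1 := by
      have := congrArg X hn
      rwa [map_mul, map_pow, map_pow, hXG, hX.cube n hn', one_pow, one_mul] at this
    have hXp : X p = 1 := by
      have := hX.periodic (a ^ 2 * p) (x' ^ 2 * N') ((haM.pow_left).mul_left hpM)
        (by rw [key]; simpa using hM)
      rwa [map_mul, map_mul, map_pow, map_pow, hXa, hXx, hXN, one_pow, one_mul, one_mul] at this
    rw [← hXp]
    exact hX.symbol p (by rintro rfl; simp at hp3) (not_natCast_dvd_of_isCoprime hp.out hpM dvd_rfl)
  have hp1 : HasSymbol p α 1 := by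
    obtain ⟨t, ht⟩ := hαN
    have hMN {z : ℤ} (h : IsCoprime N z) : IsCoprime z (norm α) :=
      h.symm.of_isCoprime_of_dvd_right ⟨t, ht⟩
    by_cases h3B : (3 : ℤ) ∣ B
    · have h3A : ¬ (3 : ℤ) ∣ A := fun h =>
        Int.prime_three.not_isUnit (hAB.isUnit_of_dvd' h h3B)
      have h3a : ¬ (3 : ℤ) ∣ a := fun h => h3A (h.trans (Dvd.intro_left _ hA.symm))
      have h3x : ¬ (3 : ℤ) ∣ x' := fun h =>
        Int.prime_three.not_isUnit (hx3.isUnit_of_dvd' (h.trans hx'x) dvd_rfl)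
      have h3N' : ¬ (3 : ℤ) ∣ N' := by
        intro h
        have := h.add ((h3B.mul_right B).mul_right D)
        rw [hN', ← pow_two, sub_add_cancel] at this
        exact h3A (Int.prime_three.dvd_of_dvd_pow this)
      have h3G : ¬ (3 : ℤ) ∣ G := fun h => hGB 3 Nat.prime_three h h3B
      have h3p : ¬ (3 : ℤ) ∣ p := by omega
      have h3g : (3 : ℤ) ∣ g := by
        obtain ⟨r, s, hrs⟩ := hbw
        have : g = r * (g * b) + s * (g * w) := by linear_combination (-g) * hrs
        rw [this, ← hB, ← hw]
        exact (h3B.mul_left r).add ((Dvd.intro _ rfl).mul_left s)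
      have hM {z : ℤ} (h3 : ¬ (3 : ℤ) ∣ z) (h : IsCoprime N z) : IsCoprime z (9 * norm α) :=
        ((isCoprime_three h3).pow_right (n := 2)).mul_right (hMN h)
      obtain ⟨X, hX⟩ := exists_cubicChar α (by rintro rfl; simp at ht; exact hN0 ht)
      obtain ⟨r, hr⟩ := h3g
      exact core _ X hX (Dvd.intro_left _ rfl) ⟨t * D * r ^ 2, by rw [ht, hr]; ring⟩ (hM h3a haN)
        (hM h3x hxN) (hM h3G hGN) (hM h3N' hNN') (hM h3p hpN') fun h => (h.elim h3a h3G).elim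
    · have h3g : ¬ (3 : ℤ) ∣ g := fun h => h3B (h.trans (Dvd.intro _ hB.symm))
      have h3w : (3 : ℤ) ∣ w :=
        (Int.prime_three.dvd_or_dvd (Dvd.intro c hw)).resolve_left h3g
      have h3α : (3 : ℤ) ∣ α.im := (h3w.mul_left a).trans hfα
      have h3re : ¬ (3 : ℤ) ∣ α.re := fun h =>
        Int.prime_three.not_isUnit (hαc.isUnit_of_dvd' h h3α)
      obtain ⟨X, hX⟩ := exists_cubicChar_of_primary α ⟨h3re, h3α⟩
      refine core _ X hX dvd_rfl ⟨t * (D * g ^ 2), by rw [ht]; ring⟩ (hMN haN) (hMN hxN)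
        (hMN hGN) (hMN hNN') (hMN hpN') fun h => hX.map_three hαc h3re (Dvd.dvd.trans ?_ hfα)
      have h3a : (3 : ℤ) ∣ a → (9 : ℤ) ∣ f := fun h => mul_dvd_mul h h3w
      refine h.elim h3a fun h3G => ?_
      by_cases h3D : (3 : ℤ) ∣ D
      · exact h3a (hGN' 3 Nat.prime_three h3G h3D)
      · have h3c : (3 : ℤ) ∣ c := (hG 3 Nat.prime_three h3G).2 (by norm_num) h3D
        have h9 : (3 : ℤ) ^ 2 ∣ g * w := by
          rw [← hw, pow_two]; exact mul_dvd_mul_left 3 h3c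
        have : IsCoprime ((3 : ℤ) ^ 2) g := ((isCoprime_three h3g).symm).pow_left
        exact (this.dvd_of_dvd_mul_left h9).mul_left a
  have : ((B * x : ℤ) : Eis) + ((3 * A * c : ℤ) : Eis) * sqrtNegThree =
      ((g * h * m : ℤ) : Eis) * α := by
    have h3 : 3 * A * c = A * (g * w) := by rw [← hw]; ring
    rw [h3, hx, hA, hB]
    push_cast
    rw [mul_assoc _ (m : Eis), ← hα, he, hf]
    push_cast
    ring
  rw [this]
  exact hp1.intCast_mul _

lemma pow_eq_of_hasSymbol {p : ℕ} [Fact p.Prime] (hp3 : p ≠ 3) {A B D c x : ℤ}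
    (hrep : (p : ℤ) ∣ x ^ 2 + 27 * c ^ 2 * D) (hc : ¬ (p : ℤ) ∣ c)
    (h : HasSymbol p (((B * x : ℤ) : Eis) + ((3 * A * c : ℤ) : Eis) * sqrtNegThree) 1)
    {s : ZMod p} (hs : s ^ 2 = D) :
    ((A : ZMod p) - B * s) ^ ((p ^ 2 - 1) / 3) = (A + B * s) ^ ((p ^ 2 - 1) / 3) := by
  obtain ⟨φ⟩ := exists_hom p
  have hφ := h φ
  have hstar : star (((B * x : ℤ) : Eis) + ((3 * A * c : ℤ) : Eis) * sqrtNegThree) =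
      ((B * x : ℤ) : Eis) - ((3 * A * c : ℤ) : Eis) * sqrtNegThree := by
    ext
    · simp; ring
    · simp
  have hσ : φ sqrtNegThree ^ 2 = -3 := by
    rw [← map_pow, show sqrtNegThree ^ 2 = ((-3 : ℤ) : Eis) by decide, map_intCast]; norm_num
  rw [hstar, map_sub, map_add, map_mul, map_intCast, map_intCast, map_one, one_mul] at hφ
  push_cast at hφ
  set σ := φ sqrtNegThree
  apply (algebraMap (ZMod p) (Fbar p)).injective
  simp only [map_pow, map_sub, map_add, map_mul, map_intCast]
  have hS : algebraMap (ZMod p) (Fbar p) s ^ 2 = (D : Fbar p) := by rw [← map_pow, hs, map_intCast]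
  set S := algebraMap (ZMod p) (Fbar p) s
  have hx : (x : Fbar p) ^ 2 = (3 * c * σ * S) ^ 2 := by
    have h0 : ((x ^ 2 + 27 * c ^ 2 * D : ℤ) : Fbar p) = 0 :=
      (CharP.intCast_eq_zero_iff (Fbar p) p _).2 hrep
    push_cast at h0
    linear_combination h0 - 9 * c ^ 2 * S ^ 2 * hσ + 27 * c ^ 2 * hS
  have hu : (3 * c * σ) ^ ((p ^ 2 - 1) / 3) ≠ 0 := by
    have h3 := three_ne_zero' hp3
    refine pow_ne_zero _ (mul_ne_zero (mul_ne_zero h3 (intCast_ne_zero hc)) fun h => h3 ?_)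
    rw [h] at hσ
    linear_combination hσ
  apply mul_left_cancel₀ hu
  have hneg (z : Fbar p) : (-z) ^ ((p ^ 2 - 1) / 3) = z ^ ((p ^ 2 - 1) / 3) := by
    rw [neg_pow, HasSymbol.neg_one_pow, one_mul]
  rw [← mul_pow, ← mul_pow]
  rcases sq_eq_sq_iff_eq_or_eq_neg.1 hx with hx | hx <;> rw [hx] at hφ
  · rw [← hneg]
    convert hφ using 2 <;> ring
  · rw [← hneg (_ * (_ + _)), eq_comm]
    convert hφ using 2 <;> ring

lemma exists_pow_three_eq {p m : ℕ} [Fact p.Prime] (hp : p = 3 * m + 1) {v : ZMod p}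
    (hv : v ^ m = 1) : ∃ t, t ^ 3 = v := by
  have hp1 := (Fact.out : p.Prime).one_lt
  have hm : 0 < m := by omega
  have hv0 : v ≠ 0 := by rintro rfl; rw [zero_pow hm.ne'] at hv; exact zero_ne_one hv
  obtain ⟨u, rfl⟩ : IsUnit v := hv0.isUnit
  obtain ⟨g, hg⟩ := IsCyclic.exists_generator (α := (ZMod p)ˣ)
  obtain ⟨j, rfl⟩ := Subgroup.mem_zpowers_iff.1 (hg u)
  have hord : (orderOf g : ℤ) = m * 3 := by
    rw [orderOf_eq_card_of_forall_mem_zpowers hg, Nat.card_eq_fintype_card,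
      ZMod.card_units]
    omega
  have hj : (g ^ j) ^ m = 1 := by ext; simpa using hv
  rw [← zpow_natCast, ← zpow_mul, ← orderOf_dvd_iff_zpow_eq_one, hord, mul_comm j] at hj
  obtain ⟨i, rfl⟩ := Int.dvd_of_mul_dvd_mul_left (by omega) hj
  refine ⟨(g ^ i : (ZMod p)ˣ), ?_⟩
  rw [← Units.val_pow_eq_pow_val, ← zpow_natCast, ← zpow_mul, mul_comm i]
  rfl

end Eis

lemma not_dvd_Cval {A B D : ℤ} {p : ℕ} (hp : p.Prime) (h : ¬ (p : ℤ) ∣ A ^ 2 - B ^ 2 * D) :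
    ¬ (p : ℤ) ∣ Cval A B D := by
  intro hC
  rw [Cval, (Nat.prime_iff_prime_int.1 hp).dvd_finsetProd_iff] at hC
  obtain ⟨q, hq, hpq⟩ := hC
  have hqG := Nat.dvd_of_mem_primeFactors (Finset.mem_filter.1 hq).1
  have hpG : (p : ℤ) ∣ Int.gcd A B := hpq.trans (Int.natCast_dvd_natCast.2 hqG)
  exact h (dvd_sub (dvd_pow (hpG.trans (Int.gcd_dvd_left _ _)) two_ne_zero)
    ((dvd_pow (hpG.trans (Int.gcd_dvd_right _ _)) two_ne_zero).mul_right D))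

lemma dvd_Cval {A B D : ℤ} {q : ℕ} (hq : q.Prime) (hG : q ∣ Int.gcd A B)
    (h0 : Int.gcd A B ≠ 0) (h2 : q ≠ 2) (hD : ¬ (q : ℤ) ∣ D) : (q : ℤ) ∣ Cval A B D :=
  Finset.dvd_prod_of_mem (fun q : ℕ => (q : ℤ)) (Finset.mem_filter.2
    ⟨Nat.mem_primeFactors.2 ⟨hq, hG, h0⟩, hq.odd_of_ne_two h2, hD⟩)

lemma prime_dvd_of_sq_mul_eq_cube {q G N n : ℤ} (hq : Prime q) (h : G ^ 2 * N = n ^ 3)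
    (hG : q ∣ G) (hG3 : ¬ q ^ 3 ∣ G) : q ∣ N := by
  by_contra hN
  have hn : q ∣ n := hq.dvd_of_dvd_pow (h ▸ (dvd_pow hG two_ne_zero).mul_right N)
  obtain ⟨n, rfl⟩ := hn
  obtain ⟨G, rfl⟩ := hG
  have hq2 := pow_ne_zero 2 hq.ne_zero
  have h1 : q * n ^ 3 = G ^ 2 * N := mul_left_cancel₀ hq2 (by linear_combination -h)
  have hG := hq.dvd_of_dvd_pow ((hq.dvd_or_dvd (h1 ▸ Dvd.intro _ rfl)).resolve_right hN)
  obtain ⟨G, rfl⟩ := hG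
  have h2 : n ^ 3 = q * (G ^ 2 * N) := mul_left_cancel₀ hq.ne_zero (by linear_combination h1)
  obtain ⟨n, rfl⟩ := hq.dvd_of_dvd_pow (h2 ▸ Dvd.intro _ rfl)
  have h3 : q * (q * n ^ 3) = G ^ 2 * N := mul_left_cancel₀ hq.ne_zero (by linear_combination h2)
  have hG := hq.dvd_of_dvd_pow ((hq.dvd_or_dvd (h3 ▸ Dvd.intro _ rfl)).resolve_right hN)
  obtain ⟨G, rfl⟩ := hG
  exact hG3 ⟨G, by ring⟩


/-- Let `p ≡ 1 (mod 3)` be a prime represented by the principal form `x² + 27C²Dy²`,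
where `D > 1` is squarefree and `C = C(u)` for `u = A + B√D ∈ 𝒮_D`.  Then (given
`gcd(p, 3N(u)D) = 1` and `y` coprime to `p`) `u` is a cubic residue mod `p`. -/
theorem stmt_4 (D A B : ℤ) (hD : 1 < D) (hsq : Squarefree D) (hu : InSD D A B)
    (p : ℕ) (hp : p.Prime) (hp3 : p % 3 = 1) (x y : ℤ)
    (hrep : (p : ℤ) = x ^ 2 + 27 * (Cval A B D) ^ 2 * D * y ^ 2)
    (hcop : IsCoprime (p : ℤ) (3 * (A ^ 2 - B ^ 2 * D) * D))
    (hy : IsCoprime y (p : ℤ)) :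
    ∀ s : ZMod p, s ^ 2 = (D : ZMod p) →
      ∃ t : ZMod p, t ^ 3 = (A : ZMod p) + (B : ZMod p) * s := by
  intro s hs
  have : Fact p.Prime := ⟨hp⟩
  have hp' := Nat.prime_iff_prime_int.1 hp
  obtain ⟨⟨n, hn⟩, -, hcube⟩ := hu
  have hpN : ¬ (p : ℤ) ∣ A ^ 2 - B ^ 2 * D :=
    fun h => hp'.not_isUnit (hcop.isUnit_of_dvd' dvd_rfl ((h.mul_left 3).mul_right D))
  have hpD : ¬ (p : ℤ) ∣ D := fun h => hp'.not_isUnit (hcop.isUnit_of_dvd' dvd_rfl (h.mul_left _))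
  have hp3' : ¬ (p : ℤ) ∣ 3 := fun h =>
    hp'.not_isUnit (hcop.isUnit_of_dvd' dvd_rfl ((h.mul_right _).mul_right D))
  have hpc : ¬ (p : ℤ) ∣ Cval A B D * y := by
    intro h
    rcases hp'.dvd_or_dvd h with h | h
    · exact not_dvd_Cval hp hpN h
    · exact hp'.not_isUnit (hy.isUnit_of_dvd' h dvd_rfl)
  have hrep' : (p : ℤ) = x ^ 2 + 27 * (Cval A B D * y) ^ 2 * D := by rw [hrep]; ring
  have hG0 : 0 < Int.gcd A B := by
    rw [Int.gcd_pos_iff]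
    by_contra! h
    rw [h.1, h.2] at hpN
    simp at hpN
  obtain ⟨A', B', hAB, hA, hB⟩ := Int.exists_gcd_one hG0
  set G : ℕ := Int.gcd A B with hG
  have hN : A ^ 2 - B ^ 2 * D = G ^ 2 * (A' ^ 2 - B' ^ 2 * D) := by rw [hA, hB]; ring
  have hxc : IsCoprime x (3 * (Cval A B D * y) * D) := by
    have hpx : ¬ (p : ℤ) ∣ 3 * (Cval A B D * y) * D := fun h =>
      (hp'.dvd_or_dvd h).elim (fun h => (hp'.dvd_or_dvd h).elim hp3' hpc) hpD
    refine isCoprime_of_prime_dvd (fun h => hpx (h.2 ▸ dvd_zero _)) fun z hz hzx hzc => hpx ?_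
    have hzp : z ∣ p := by
      have hz' : z ∣ 27 * (Cval A B D * y) ^ 2 * D := by
        have : 27 * (Cval A B D * y) ^ 2 * D =
            9 * (Cval A B D * y) * (3 * (Cval A B D * y) * D) := by ring
        exact this ▸ hzc.mul_left _
      rw [hrep']
      exact (dvd_pow hzx two_ne_zero).add hz'
    exact ((hz.associated_of_dvd hp' hzp).symm.dvd).trans hzc
  have hsymb := Eis.hasSymbol_of_eq_add hp3 (Int.isCoprime_iff_gcd_eq_one.2 hAB) hrep'
    (hN.symm.trans hn) hxc (fun h => hpN (hN ▸ h.mul_left _)) fun q hq hqG =>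
      ⟨prime_dvd_of_sq_mul_eq_cube (Nat.prime_iff_prime_int.1 hq) (hN.symm.trans hn) hqG
        (by exact_mod_cast hcube q hq),
      fun h2 hqD => (dvd_Cval hq (Int.natCast_dvd_natCast.1 hqG) hG0.ne' h2 hqD).mul_right y⟩
  have hpow := Eis.pow_eq_of_hasSymbol (by omega) (dvd_of_eq hrep') hpc hsymb hs
  set v : ZMod p := A + B * s with hv
  obtain ⟨m, hm⟩ : ∃ m, p = 3 * m + 1 := ⟨p / 3, by omega⟩
  have hk : (p ^ 2 - 1) / 3 = m * (3 * m + 2) := by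
    rw [hm]
    refine Nat.div_eq_of_eq_mul_right three_pos (Nat.sub_eq_of_eq_add ?_)
    ring
  have hfermat {z : ZMod p} (hz : z ≠ 0) : z ^ (3 * m) = 1 := by
    rw [← ZMod.pow_card_sub_one_eq_one hz]; congr 1; omega
  have hvn : (A - B * s) * v = (n : ZMod p) ^ 3 := by
    have := congrArg (Int.cast : ℤ → ZMod p) hn
    push_cast at this
    rw [hv]
    linear_combination this - B ^ 2 * hs
  have hn0 : (n : ZMod p) ≠ 0 := by
    rw [Ne, ZMod.intCast_zmod_eq_zero_iff_dvd]
    exact fun h => hpN (hn ▸ dvd_pow h three_ne_zero)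
  have hv0 : v ≠ 0 := by
    intro h
    rw [h, mul_zero] at hvn
    exact pow_ne_zero 3 hn0 hvn.symm
  refine Eis.exists_pow_three_eq hm ?_
  have hpow' : ((A : ZMod p) - B * s) ^ (m * (3 * m + 2)) = v ^ (m * (3 * m + 2)) := by
    have h := congrArg ((G : ZMod p) ^ (m * (3 * m + 2)) * ·) hpow
    simp only [hk, ← mul_pow] at h
    have hA' := congrArg (Int.cast : ℤ → ZMod p) hA
    have hB' := congrArg (Int.cast : ℤ → ZMod p) hB
    push_cast at hA' hB'
    rw [hv, hA', hB']
    convert h using 2 <;> ring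
  have h1 : v ^ (2 * (m * (3 * m + 2))) = 1 := by
    calc v ^ (2 * (m * (3 * m + 2))) = ((A - B * s) * v) ^ (m * (3 * m + 2)) := by
          rw [mul_pow, hpow']; ring
      _ = ((n : ZMod p) ^ (3 * m)) ^ (3 * m + 2) := by rw [hvn]; ring
      _ = 1 := by rw [hfermat hn0, one_pow]
  have h3 := hfermat hv0
  calc v ^ m = v ^ (2 * (m * (3 * m + 2))) := by
        rw [show 2 * (m * (3 * m + 2)) = 3 * m * (2 * m + 1) + m by ring, pow_add, pow_mul, h3,
          one_pow, one_mul]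
    _ = 1 := h1
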